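/- Let f0 = e_{(0,2)}+e_{(1,1)}−e_{(2,0)}, f1 = e_{(0,2)}+e_{(2,0)}, f2 = e_{(0,1)}+e_{(1,0)}, f3 = e_{(1,2)}+e_{(2,1)}, f4 = e_{(0,0)}, f5 = e_{(2,2)} in ℂ^(Fin 3 × Fin 3). Then the partial transpose on B of ρ3 satisfies (ρ3)^{T_B} = f0 f0* + 2 f1 f1* + f2 f2* + f3 f3* + f4 f4* + f5 f5*; in particular (ρ3)^{T_B} is positive semidefinite, so ρ3 is PPT. -/

import Mathlib

open Matrix Kronecker ComplexOrder

/-- The Schmidt rank of a vector `ψ ∈ ℂ^(Fin m × Fin n)`: the rank of the associated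
`m × n` matrix with `(i,j)` entry `ψ (i,j)`. -/
noncomputable def schmidtRank {m n : ℕ} (ψ : Fin m × Fin n → ℂ) : ℕ :=
  (Matrix.of fun i j => ψ (i, j) : Matrix (Fin m) (Fin n) ℂ).rank

/-- Rank-one outer product `v v*`. -/
def outer {d : Type*} (v : d → ℂ) : Matrix d d ℂ :=
  Matrix.of fun a b => v a * star (v b)

/-- `SNle ρ k` : the Schmidt number of `ρ` is at most `k`, i.e. `ρ` is a finite sum of
outer products of vectors of Schmidt rank at most `k`. -/
def SNle {m n : ℕ} (ρ : Matrix (Fin m × Fin n) (Fin m × Fin n) ℂ) (k : ℕ) : Prop :=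
  ∃ (T : ℕ) (v : Fin T → (Fin m × Fin n → ℂ)),
    (∀ t, schmidtRank (v t) ≤ k) ∧ ρ = ∑ t, outer (v t)

/-- Partial transpose on the second (B) subsystem. -/
def ptB {m n : ℕ} (ρ : Matrix (Fin m × Fin n) (Fin m × Fin n) ℂ) :
    Matrix (Fin m × Fin n) (Fin m × Fin n) ℂ :=
  Matrix.of fun p q => ρ (p.1, q.2) (q.1, p.2)

/-- Partial transpose on the first (A) subsystem. -/
def ptA {m n : ℕ} (ρ : Matrix (Fin m × Fin n) (Fin m × Fin n) ℂ) :
    Matrix (Fin m × Fin n) (Fin m × Fin n) ℂ :=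
  Matrix.of fun p q => ρ (q.1, p.2) (p.1, q.2)


/-- Standard basis vector of `ℂ^(Fin 3 × Fin 3)`. -/
def eb (q : Fin 3 × Fin 3) : Fin 3 × Fin 3 → ℂ := fun p => if p = q then 1 else 0

/-- The generalized grid state `ρ^{3×3}`. -/
noncomputable def rho3 : Matrix (Fin 3 × Fin 3) (Fin 3 × Fin 3) ℂ :=
  outer (eb (0, 0) + eb (1, 1) + eb (2, 2))
  + outer (eb (0, 1) + eb (1, 2))
  + outer (eb (1, 0) - eb (2, 1))
  + (3 : ℂ) • outer (eb (0, 2))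
  + (3 : ℂ) • outer (eb (2, 0))


set_option maxHeartbeats 4000000 in
/-- Explicit decomposition of the partial transpose of `ρ^{3×3}`; in particular it is
positive semidefinite, so `ρ^{3×3}` is PPT. -/
theorem rho3_partial_transpose_decomposition :
    ptB rho3
      = outer (eb (0, 2) + eb (1, 1) - eb (2, 0))
        + (2 : ℂ) • outer (eb (0, 2) + eb (2, 0))
        + outer (eb (0, 1) + eb (1, 0))
        + outer (eb (1, 2) + eb (2, 1))
        + outer (eb (0, 0))
        + outer (eb (2, 2))
    ∧ (ptB rho3).PosSemidef := by
  have h : ptB rho3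
      = outer (eb (0, 2) + eb (1, 1) - eb (2, 0))
        + (2 : ℂ) • outer (eb (0, 2) + eb (2, 0))
        + outer (eb (0, 1) + eb (1, 0))
        + outer (eb (1, 2) + eb (2, 1))
        + outer (eb (0, 0))
        + outer (eb (2, 2)) := by
    ext ⟨i, j⟩ ⟨k, l⟩
    fin_cases i <;> fin_cases j <;> fin_cases k <;> fin_cases l <;>
      simp [ptB, rho3, outer, eb] <;> norm_num
  refine ⟨h, ?_⟩
  have ho : ∀ v : Fin 3 × Fin 3 → ℂ, (outer v).PosSemidef := fun v =>
    Matrix.posSemidef_vecMulVec_self_star v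
  rw [h]
  exact (((((ho _).add ((ho _).smul (by norm_num))).add (ho _)).add (ho _)).add (ho _)).add (ho _)
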